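/- For every u ∈ (1/2,1), there exists a unique μ̃ ∈ (0,1) such that φ(u,μ̃) = 1, where φ(u,μ) := dc²(K(1−μ)u | 1−μ) − dc²(K(μ)u | μ); moreover this unique solution satisfies μ̃ ∈ (1/2,1), and φ(u,μ) < 1 for μ < μ̃ while φ(u,μ) > 1 for μ > μ̃. -/

import Mathlib

noncomputable section

open Complex Filter Set Asymptotics

/-- Complete elliptic integral of the first kind with complex parameter `m`,
using the principal branch of the square root. -/
def ellK (m : ℂ) : ℂ :=
  ∫ t in (0:ℝ)..1, 1 / ((1 - (t : ℂ) ^ 2) * (1 - m * (t : ℂ) ^ 2)) ^ ((1 : ℂ) / 2)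

/-- The nome `q = exp (-π K(1-m)/K(m))`. -/
def nome (m : ℂ) : ℂ := Complex.exp (-(Real.pi : ℂ) * ellK (1 - m) / ellK m)

/-- Jacobi theta function θ₁(z, q). -/
def theta1 (z q : ℂ) : ℂ :=
  2 * ∑' n : ℕ, (-1 : ℂ) ^ n * q ^ (((n : ℂ) + 1 / 2) ^ 2) *
    Complex.sin ((2 * (n : ℂ) + 1) * z)

/-- Jacobi theta function θ₂(z, q). -/
def theta2 (z q : ℂ) : ℂ :=
  2 * ∑' n : ℕ, q ^ (((n : ℂ) + 1 / 2) ^ 2) * Complex.cos ((2 * (n : ℂ) + 1) * z)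

/-- Jacobi theta function θ₃(z, q). -/
def theta3 (z q : ℂ) : ℂ :=
  1 + 2 * ∑' n : ℕ, q ^ ((n + 1) ^ 2) * Complex.cos (2 * ((n : ℂ) + 1) * z)

/-- Jacobi theta function θ₄(z, q). -/
def theta4 (z q : ℂ) : ℂ :=
  1 + 2 * ∑' n : ℕ, (-1 : ℂ) ^ (n + 1) * q ^ ((n + 1) ^ 2) *
    Complex.cos (2 * ((n : ℂ) + 1) * z)

/-- Jacobian elliptic function sn(z | m) with complex argument and parameter,
defined through quotients of Jacobi theta functions with nome
`q = exp (-π K(1-m)/K(m))` (so that `sn (K m * u) m` corresponds to the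
theta quotient at `π u / 2`). -/
def sn (z m : ℂ) : ℂ :=
  (theta3 0 (nome m) / theta2 0 (nome m)) *
    (theta1 ((Real.pi : ℂ) * z / (2 * ellK m)) (nome m) /
      theta4 ((Real.pi : ℂ) * z / (2 * ellK m)) (nome m))

/-- Jacobian elliptic function cn(z | m). -/
def cn (z m : ℂ) : ℂ :=
  (theta4 0 (nome m) / theta2 0 (nome m)) *
    (theta2 ((Real.pi : ℂ) * z / (2 * ellK m)) (nome m) /
      theta4 ((Real.pi : ℂ) * z / (2 * ellK m)) (nome m))

/-- Jacobian elliptic function dn(z | m). -/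
def dn (z m : ℂ) : ℂ :=
  (theta4 0 (nome m) / theta3 0 (nome m)) *
    (theta3 ((Real.pi : ℂ) * z / (2 * ellK m)) (nome m) /
      theta4 ((Real.pi : ℂ) * z / (2 * ellK m)) (nome m))

/-- The lattice ratio τ = i K(1-m)/K(m). -/
def tauC (m : ℂ) : ℂ := Complex.I * ellK (1 - m) / ellK m

/-- Subsidiary Jacobian elliptic function sc = sn/cn. -/
def sc (z m : ℂ) : ℂ := sn z m / cn z m

/-- Subsidiary Jacobian elliptic function nc = 1/cn. -/
def nc (z m : ℂ) : ℂ := 1 / cn z m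

/-- Subsidiary Jacobian elliptic function dc = dn/cn. -/
def dcC (z m : ℂ) : ℂ := dn z m / cn z m

/-- The branch cut [1, ∞) on the real axis. -/
def cut : Set ℂ := {z : ℂ | z.im = 0 ∧ 1 ≤ z.re}

/-- Real complete elliptic integral of the first kind (for real parameter `m < 1`
the complex integral is real-valued). -/
def KR (m : ℝ) : ℝ := (ellK (m : ℂ)).re

/-- Classical real Jacobian elliptic function sn(x | m). -/
def snR (x m : ℝ) : ℝ := (sn (x : ℂ) (m : ℂ)).re

/-- Classical real Jacobian elliptic function cn(x | m). -/
def cnR (x m : ℝ) : ℝ := (cn (x : ℂ) (m : ℂ)).re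

/-- Classical real Jacobian elliptic function dn(x | m). -/
def dnR (x m : ℝ) : ℝ := (dn (x : ℂ) (m : ℂ)).re

/-- φ(u, μ) = dc²(K(1-μ)u | 1-μ) − dc²(K(μ)u | μ) with real dc = dn/cn. -/
def phi (u μ : ℝ) : ℝ :=
  (dnR (KR (1 - μ) * u) (1 - μ) / cnR (KR (1 - μ) * u) (1 - μ)) ^ 2 -
    (dnR (KR μ * u) μ / cnR (KR μ * u) μ) ^ 2

/-- The square of the continuously extended modulus |sn(K(m)u | m)|² for `m > 1`,
given by μ(s²d₁² + c²d²s₁²c₁²)/(1 − d²s₁²)² with μ = 1/m, μ₁ = 1 − μ. -/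
def snAbsSq (u m : ℝ) : ℝ :=
  let μ := 1 / m
  let μ₁ := 1 - μ
  let s := snR (KR μ * u) μ
  let c := cnR (KR μ * u) μ
  let d := dnR (KR μ * u) μ
  let s₁ := snR (KR μ₁ * u) μ₁
  let c₁ := cnR (KR μ₁ * u) μ₁
  let d₁ := dnR (KR μ₁ * u) μ₁
  μ * (s ^ 2 * d₁ ^ 2 + c ^ 2 * d ^ 2 * s₁ ^ 2 * c₁ ^ 2) / (1 - d ^ 2 * s₁ ^ 2) ^ 2

/-- integrand of the real elliptic integral -/
def kf (m t : ℝ) : ℝ := 1 / Real.sqrt ((1 - t ^ 2) * (1 - m * t ^ 2))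

/-- real elliptic integral -/
def Kr (m : ℝ) : ℝ := ∫ t in (0:ℝ)..1, kf m t

/-- dominating function -/
def kB (m t : ℝ) : ℝ := 1 / Real.sqrt ((1 - m) * (1 - t))

lemma ellK_eq (m : ℝ) (h1 : m < 1) : ellK (m : ℂ) = ((Kr m : ℝ) : ℂ) := by
  unfold ellK Kr
  rw [← intervalIntegral.integral_ofReal]
  apply intervalIntegral.integral_congr
  intro t ht
  rw [uIcc_of_le zero_le_one] at ht
  have h2 : t ^ 2 ≤ 1 := by nlinarith [ht.1, ht.2]
  have h3 : 0 ≤ t ^ 2 := sq_nonneg t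
  have h4 : 0 ≤ (1 - t ^ 2) * (1 - m * t ^ 2) := by
    apply mul_nonneg
    · linarith
    · nlinarith
  simp only [kf]
  rw [Real.sqrt_eq_rpow]
  push_cast
  rw [Complex.ofReal_cpow h4]
  push_cast
  rfl

lemma kB_int (m : ℝ) (h1 : m < 1) : IntervalIntegrable (kB m) MeasureTheory.volume 0 1 := by
  have h := (intervalIntegral.intervalIntegrable_rpow' (a := 0) (b := 1) (r := -(1/2 : ℝ)) (by norm_num))
  have h' := ((h.comp_sub_left 1).symm).const_mul (1 / Real.sqrt (1 - m))
  simp only [sub_self, sub_zero] at h'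
  refine h'.congr ?_
  intro t ht
  rw [uIoc_of_le zero_le_one] at ht
  simp only [kB]
  rw [Real.sqrt_mul (by linarith), Real.rpow_neg (by linarith [ht.2]), ← Real.sqrt_eq_rpow]
  field_simp

lemma kf_nonneg (m t : ℝ) : 0 ≤ kf m t := by unfold kf; positivity

lemma kf_meas (m : ℝ) : Measurable (kf m) := by unfold kf; fun_prop

lemma kf_le (m m0 t : ℝ) (hm : m ≤ m0) (h1 : m0 < 1) (h0 : 0 ≤ m0) (ht : t ∈ Ioc (0:ℝ) 1) :
    kf m t ≤ kB m0 t := by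
  obtain ⟨ht0, ht1⟩ := ht
  unfold kf kB
  rcases eq_or_lt_of_le ht1 with rfl | ht1
  · simp
  · have : 0 < (1 - m0) * (1 - t) := by apply mul_pos <;> linarith
    apply one_div_le_one_div_of_le (Real.sqrt_pos.2 this)
    apply Real.sqrt_le_sqrt
    rw [mul_comm]
    have ht2 : t ^ 2 ≤ t := by nlinarith
    apply mul_le_mul
    · linarith
    · nlinarith [sq_nonneg t]
    · linarith
    · nlinarith

lemma kf_int (m : ℝ) (h0 : 0 ≤ m) (h1 : m < 1) :
    IntervalIntegrable (kf m) MeasureTheory.volume 0 1 := by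
  refine (kB_int m h1).mono_fun (kf_meas m).aestronglyMeasurable ?_
  refine (MeasureTheory.ae_restrict_iff' measurableSet_uIoc).2 (Eventually.of_forall ?_)
  intro t ht
  rw [uIoc_of_le zero_le_one] at ht
  have := kf_le m m t le_rfl h1 h0 ht
  have h2 := kf_nonneg m t
  show ‖kf m t‖ ≤ ‖kB m t‖
  rw [Real.norm_of_nonneg h2, Real.norm_of_nonneg (h2.trans this)]
  exact this

lemma kf_pos (m t : ℝ) (h1 : m < 1) (ht : t ∈ Ioo (0:ℝ) 1) :
    0 < (1 - t ^ 2) * (1 - m * t ^ 2) := by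
  obtain ⟨ht0, ht1⟩ := ht
  have h2 : t ^ 2 < 1 := by nlinarith
  have h3 : 0 < t ^ 2 := by positivity
  apply mul_pos
  · linarith
  · nlinarith

lemma Kr_pos (m : ℝ) (h0 : 0 ≤ m) (h1 : m < 1) : 0 < Kr m := by
  apply intervalIntegral.intervalIntegral_pos_of_pos_on (kf_int m h0 h1) _ one_pos
  intro t ht
  have := kf_pos m t h1 ht
  unfold kf
  positivity

lemma Kr_lt (m n : ℝ) (h0 : 0 ≤ m) (hmn : m < n) (h1 : n < 1) : Kr m < Kr n := by
  rw [← sub_pos]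
  unfold Kr
  rw [← intervalIntegral.integral_sub (kf_int n (by linarith) h1) (kf_int m h0 (by linarith))]
  apply intervalIntegral.intervalIntegral_pos_of_pos_on
    ((kf_int n (by linarith) h1).sub (kf_int m h0 (by linarith))) _ one_pos
  intro t ht
  have hp := kf_pos n t h1 ht
  rw [sub_pos]
  unfold kf
  apply one_div_lt_one_div_of_lt (Real.sqrt_pos.2 hp)
  apply Real.sqrt_lt_sqrt hp.le
  obtain ⟨ht0, ht1⟩ := ht
  have h2 : t ^ 2 < 1 := by nlinarith
  have h3 : 0 < t ^ 2 := by positivity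
  apply mul_lt_mul_of_pos_left _ (by linarith)
  nlinarith

lemma Kr_cont (m : ℝ) (h0 : 0 < m) (h1 : m < 1) : ContinuousAt Kr m := by
  obtain ⟨m0, hm, hm0⟩ := exists_between h1
  refine intervalIntegral.continuousAt_of_dominated_interval (bound := kB m0)
    (Eventually.of_forall fun x => (kf_meas x).aestronglyMeasurable) ?_ (kB_int m0 hm0) ?_
  · filter_upwards [Iio_mem_nhds hm] with x hx
    refine Eventually.of_forall fun t ht => ?_
    rw [uIoc_of_le zero_le_one] at ht
    rw [Real.norm_of_nonneg (kf_nonneg x t)]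
    exact kf_le x m0 t (le_of_lt hx) hm0 (by linarith) ht
  · refine Eventually.of_forall fun t ht => ?_
    rw [uIoc_of_le zero_le_one] at ht
    rcases eq_or_lt_of_le ht.2 with rfl | ht1
    · simp [kf, continuousAt_const]
    · have := kf_pos m t h1 ⟨ht.1, ht1⟩
      unfold kf
      have hc : ContinuousAt (fun x : ℝ => Real.sqrt ((1 - t ^ 2) * (1 - x * t ^ 2))) m := by
        fun_prop
      exact ContinuousAt.div continuousAt_const hc (Real.sqrt_pos.2 this).ne'

lemma Kr_lower (m : ℝ) (h0 : 0 < m) (h1 : m < 1) :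
    (1/2) * Real.log ((3 - m) / (1 - m)) ≤ Kr m := by
  have e : ∫ t in (0:ℝ)..1, ((3 - m) - 2 * t)⁻¹ = (1/2) * Real.log ((3 - m) / (1 - m)) := by
    rw [intervalIntegral.integral_comp_sub_mul (fun x => x⁻¹) (two_ne_zero) (3 - m)]
    rw [integral_inv_of_pos (by linarith) (by linarith)]
    rw [smul_eq_mul]
    congr 2
    · norm_num
    · congr 1 <;> ring
  rw [← e]
  unfold Kr
  apply intervalIntegral.integral_mono_on_of_le_Ioo zero_le_one _ (kf_int m h0.le h1)
  · intro t ht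
    have hp := kf_pos m t h1 ht
    obtain ⟨ht0, ht1⟩ := ht
    have h2 : t ^ 2 < 1 := by nlinarith
    have h3 : 0 < t ^ 2 := by positivity
    unfold kf
    rw [← one_div]
    apply one_div_le_one_div_of_le (Real.sqrt_pos.2 hp)
    rw [Real.sqrt_le_left (by linarith)]
    have a1 : 1 - t ^ 2 ≤ (3 - m) - 2 * t := by nlinarith
    have a2 : 1 - m * t ^ 2 ≤ (3 - m) - 2 * t := by nlinarith
    rw [pow_two ((3 - m) - 2 * t)]
    apply mul_le_mul a1 a2 (by nlinarith) (by linarith)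
  · apply ContinuousOn.intervalIntegrable
    intro t ht
    rw [uIcc_of_le zero_le_one] at ht
    apply ContinuousWithinAt.inv₀ (by fun_prop)
    linarith [ht.2]

lemma Kr_tendsto : Tendsto Kr (nhdsWithin 1 (Iio 1)) atTop := by
  have h1 : Tendsto (fun m : ℝ => (1/2) * Real.log ((3 - m) / (1 - m))) (nhdsWithin 1 (Iio 1)) atTop := by
    apply Tendsto.const_mul_atTop (by norm_num)
    apply Real.tendsto_log_atTop.comp
    have a : Tendsto (fun m : ℝ => 3 - m) (nhdsWithin 1 (Iio 1)) (nhds 2) := by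
      have : ContinuousAt (fun m : ℝ => 3 - m) 1 := by fun_prop
      have := this.tendsto
      norm_num at this
      exact this.mono_left nhdsWithin_le_nhds
    have b : Tendsto (fun m : ℝ => (1 - m)⁻¹) (nhdsWithin 1 (Iio 1)) atTop := by
      apply tendsto_inv_nhdsGT_zero.comp
      rw [tendsto_nhdsWithin_iff]
      constructor
      · have : ContinuousAt (fun m : ℝ => 1 - m) 1 := by fun_prop
        have := this.tendsto
        norm_num at this
        exact this.mono_left nhdsWithin_le_nhds
      · filter_upwards [self_mem_nhdsWithin] with x hx
        simpa using hx
    exact a.pos_mul_atTop (by norm_num) b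
  refine tendsto_atTop_mono' _ ?_ h1
  have : Ioo (0:ℝ) 1 ∈ nhdsWithin (1:ℝ) (Iio 1) := Ioo_mem_nhdsLT one_pos
  filter_upwards [this] with m hm
  exact Kr_lower m hm.1 hm.2

/-- real nome -/
def qr (m : ℝ) : ℝ := Real.exp (-Real.pi * Kr (1 - m) / Kr m)

lemma nome_eq (m : ℝ) (h0 : 0 < m) (h1 : m < 1) : nome (m : ℂ) = ((qr m : ℝ) : ℂ) := by
  unfold nome qr
  have : (1 : ℂ) - (m : ℂ) = ((1 - m : ℝ) : ℂ) := by push_cast; rfl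
  rw [this, ellK_eq m h1, ellK_eq (1 - m) (by linarith)]
  push_cast
  rfl

lemma qr_pos (m : ℝ) : 0 < qr m := Real.exp_pos _

lemma qr_lt_one (m : ℝ) (h0 : 0 < m) (h1 : m < 1) : qr m < 1 := by
  unfold qr
  rw [Real.exp_lt_one_iff]
  have a := Kr_pos m h0.le h1
  have b := Kr_pos (1 - m) (by linarith) (by linarith)
  have : 0 < Real.pi * Kr (1 - m) / Kr m := by have := Real.pi_pos; positivity
  rw [neg_mul, neg_div]
  linarith

lemma qr_lt (m n : ℝ) (h0 : 0 < m) (hmn : m < n) (h1 : n < 1) : qr m < qr n := by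
  unfold qr
  rw [Real.exp_lt_exp, neg_mul, neg_div, neg_mul, neg_div, neg_lt_neg_iff]
  have a := Kr_pos m h0.le (by linarith)
  have b := Kr_pos (1 - n) (by linarith) (by linarith)
  have c := Kr_lt m n h0.le hmn h1
  have d := Kr_lt (1 - n) (1 - m) (by linarith) (by linarith) (by linarith)
  have := Real.pi_pos
  apply div_lt_div₀ _ c.le _ a
  · exact mul_lt_mul_of_pos_left d this
  · exact mul_nonneg this.le (b.trans d).le

lemma qr_cont (m : ℝ) (h0 : 0 < m) (h1 : m < 1) : ContinuousAt qr m := by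
  unfold qr
  have a := Kr_pos m h0.le (by linarith)
  have c1 := Kr_cont m h0 h1
  have c2 : ContinuousAt (fun m => Kr (1 - m)) m := by
    apply ContinuousAt.comp (g := Kr) (Kr_cont (1 - m) (by linarith) (by linarith))
    fun_prop
  exact Real.continuous_exp.continuousAt.comp ((continuousAt_const.mul c2).div c1 a.ne')

lemma ratio_tendsto : Tendsto (fun m => Kr (1 - m) / Kr m) (nhdsWithin 1 (Iio 1)) (nhds 0) := by
  have h : Tendsto (fun m => Kr (1/2) * (Kr m)⁻¹) (nhdsWithin 1 (Iio 1)) (nhds 0) := by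
    have := (tendsto_inv_atTop_zero.comp Kr_tendsto).const_mul (Kr (1/2))
    simpa using this
  refine tendsto_of_tendsto_of_tendsto_of_le_of_le' tendsto_const_nhds h ?_ ?_
  all_goals
    have : Ioo (1/2:ℝ) 1 ∈ nhdsWithin (1:ℝ) (Iio 1) := Ioo_mem_nhdsLT (by norm_num)
    filter_upwards [this] with m hm
    have a := Kr_pos m (by linarith [hm.1]) hm.2
    have b := Kr_pos (1 - m) (by linarith [hm.2]) (by linarith [hm.1])
  · positivity
  · rw [div_eq_mul_inv]
    apply mul_le_mul_of_nonneg_right _ (by positivity)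
    exact (Kr_lt _ _ (by linarith [hm.2]) (by linarith [hm.1]) (by norm_num)).le

lemma qr_tendsto_one : Tendsto qr (nhdsWithin 1 (Iio 1)) (nhdsWithin 1 (Iio 1)) := by
  rw [tendsto_nhdsWithin_iff]
  constructor
  · have h := (Real.continuous_exp.tendsto _).comp (ratio_tendsto.const_mul (-Real.pi))
    simp only [mul_zero, Real.exp_zero] at h
    refine h.congr fun m => ?_
    simp only [qr, mul_div_assoc, Function.comp]
  · have : Ioo (0:ℝ) 1 ∈ nhdsWithin (1:ℝ) (Iio 1) := Ioo_mem_nhdsLT (by norm_num)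
    filter_upwards [this] with m hm
    exact qr_lt_one m hm.1 hm.2

lemma qr_tendsto_zero : Tendsto (fun m => qr (1 - m)) (nhdsWithin 1 (Iio 1)) (nhdsWithin 0 (Ioi 0)) := by
  rw [tendsto_nhdsWithin_iff]
  constructor
  · have h2 : Tendsto (fun m => Kr (1 - m) / Kr m) (nhdsWithin 1 (Iio 1)) (nhdsWithin 0 (Ioi 0)) := by
      rw [tendsto_nhdsWithin_iff]
      refine ⟨ratio_tendsto, ?_⟩
      have : Ioo (0:ℝ) 1 ∈ nhdsWithin (1:ℝ) (Iio 1) := Ioo_mem_nhdsLT (by norm_num)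
      filter_upwards [this] with m hm
      have a := Kr_pos m (by linarith [hm.1]) hm.2
      have b := Kr_pos (1 - m) (by linarith [hm.2]) (by linarith [hm.1])
      exact div_pos b a
    have h3 := (tendsto_inv_nhdsGT_zero.comp h2).const_mul_atTop Real.pi_pos
    have h4 := Real.tendsto_exp_neg_atTop_nhds_zero.comp h3
    refine h4.congr fun m => ?_
    simp only [Function.comp, qr, inv_div, sub_sub_cancel]
    congr 1
    ring
  · exact Eventually.of_forall fun m => qr_pos _

/-- reduced theta2 -/
def S2 (z q : ℝ) : ℝ := ∑' n : ℕ, q ^ (n * (n + 1)) * Real.cos ((2 * n + 1) * z)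

/-- reduced theta3 -/
def S3 (z q : ℝ) : ℝ := 1 + 2 * ∑' n : ℕ, q ^ ((n + 1) ^ 2) * Real.cos (2 * (n + 1) * z)

lemma bd2 (q r x : ℝ) (n : ℕ) (h0 : 0 ≤ q) (hqr : q ≤ r) (h1 : r < 1) :
    ‖q ^ (n * (n + 1)) * Real.cos x‖ ≤ r ^ n := by
  rw [norm_mul, norm_pow, Real.norm_of_nonneg h0]
  calc q ^ (n * (n + 1)) * ‖Real.cos x‖ ≤ q ^ (n * (n + 1)) * 1 := by
        apply mul_le_mul_of_nonneg_left (Real.abs_cos_le_one x) (by positivity)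
    _ ≤ r ^ (n * (n + 1)) := by rw [mul_one]; gcongr
    _ ≤ r ^ n := pow_le_pow_of_le_one (h0.trans hqr) h1.le (by nlinarith)

lemma bd3 (q r x : ℝ) (n : ℕ) (h0 : 0 ≤ q) (hqr : q ≤ r) (h1 : r < 1) :
    ‖q ^ ((n + 1) ^ 2) * Real.cos x‖ ≤ r ^ n := by
  rw [norm_mul, norm_pow, Real.norm_of_nonneg h0]
  calc q ^ ((n + 1) ^ 2) * ‖Real.cos x‖ ≤ q ^ ((n + 1) ^ 2) * 1 := by
        apply mul_le_mul_of_nonneg_left (Real.abs_cos_le_one x) (by positivity)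
    _ ≤ r ^ ((n + 1) ^ 2) := by rw [mul_one]; gcongr
    _ ≤ r ^ n := pow_le_pow_of_le_one (h0.trans hqr) h1.le (by nlinarith)

lemma sum2 (z q : ℝ) (h0 : 0 ≤ q) (h1 : q < 1) :
    Summable fun n : ℕ => q ^ (n * (n + 1)) * Real.cos ((2 * n + 1) * z) :=
  Summable.of_norm_bounded (summable_geometric_of_lt_one h0 h1) fun n => bd2 q q _ n h0 le_rfl h1

lemma sum3 (z q : ℝ) (h0 : 0 ≤ q) (h1 : q < 1) :
    Summable fun n : ℕ => q ^ ((n + 1) ^ 2) * Real.cos (2 * (n + 1) * z) :=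
  Summable.of_norm_bounded (summable_geometric_of_lt_one h0 h1) fun n => bd3 q q _ n h0 le_rfl h1

lemma S2_contOn (z r : ℝ) (h0 : 0 ≤ r) (h1 : r < 1) : ContinuousOn (S2 z) (Icc 0 r) := by
  unfold S2
  apply continuousOn_tsum (u := fun n => r ^ n) (fun n => by fun_prop)
    (summable_geometric_of_lt_one h0 h1)
  intro n x hx
  exact bd2 x r _ n hx.1 hx.2 h1

lemma S3_contOn (z r : ℝ) (h0 : 0 ≤ r) (h1 : r < 1) : ContinuousOn (S3 z) (Icc 0 r) := by
  unfold S3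
  apply ContinuousOn.add continuousOn_const
  apply ContinuousOn.mul continuousOn_const
  apply continuousOn_tsum (u := fun n => r ^ n) (fun n => by fun_prop)
    (summable_geometric_of_lt_one h0 h1)
  intro n x hx
  exact bd3 x r _ n hx.1 hx.2 h1

lemma S2_cont (z q : ℝ) (h0 : 0 < q) (h1 : q < 1) : ContinuousAt (S2 z) q := by
  obtain ⟨r, hr, hr1⟩ := exists_between h1
  exact (S2_contOn z r (by linarith) hr1).continuousAt (Icc_mem_nhds h0 hr)

lemma S3_cont (z q : ℝ) (h0 : 0 < q) (h1 : q < 1) : ContinuousAt (S3 z) q := by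
  obtain ⟨r, hr, hr1⟩ := exists_between h1
  exact (S3_contOn z r (by linarith) hr1).continuousAt (Icc_mem_nhds h0 hr)

lemma S2_zero (z : ℝ) : S2 z 0 = Real.cos z := by
  unfold S2
  rw [tsum_eq_single 0]
  · simp
  · intro n hn
    rw [zero_pow (by positivity), zero_mul]

lemma S3_zero (z : ℝ) : S3 z 0 = 1 := by
  unfold S3
  simp

lemma S2_tendsto (z : ℝ) : Tendsto (S2 z) (nhdsWithin 0 (Ioi 0)) (nhds (Real.cos z)) := by
  have h := (S2_contOn z (1/2) (by norm_num) (by norm_num)) 0 (by constructor <;> norm_num)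
  unfold ContinuousWithinAt at h
  rw [S2_zero] at h
  refine h.mono_left ?_
  rw [← nhdsWithin_Ioo_eq_nhdsGT (show (0:ℝ) < 1/2 by norm_num)]
  exact nhdsWithin_mono _ Ioo_subset_Icc_self

lemma S3_tendsto (z : ℝ) : Tendsto (S3 z) (nhdsWithin 0 (Ioi 0)) (nhds 1) := by
  have h := (S3_contOn z (1/2) (by norm_num) (by norm_num)) 0 (by constructor <;> norm_num)
  unfold ContinuousWithinAt at h
  rw [S3_zero] at h
  refine h.mono_left ?_
  rw [← nhdsWithin_Ioo_eq_nhdsGT (show (0:ℝ) < 1/2 by norm_num)]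
  exact nhdsWithin_mono _ Ioo_subset_Icc_self

lemma S2_zero_pos (q : ℝ) (h0 : 0 ≤ q) (h1 : q < 1) : 0 < S2 0 q := by
  unfold S2
  apply (sum2 0 q h0 h1).tsum_pos _ 0
  · simp
  · intro n
    simp only [mul_zero, Real.cos_zero, mul_one]
    positivity

lemma S3_zero_pos (q : ℝ) (h0 : 0 ≤ q) : 0 < S3 0 q := by
  unfold S3
  have : 0 ≤ ∑' n : ℕ, q ^ ((n + 1) ^ 2) * Real.cos (2 * (n + 1) * 0) := by
    apply tsum_nonneg
    intro n
    simp only [mul_zero, Real.cos_zero, mul_one]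
    positivity
  linarith

/-- bilateral terms -/
def A3 (z q : ℝ) (n : ℤ) : ℂ := (q : ℂ) ^ (n ^ 2) * Complex.exp (2 * n * z * I)

/-- bilateral terms -/
def A2 (z q : ℝ) (n : ℤ) : ℂ := (q : ℂ) ^ (n * (n + 1)) * Complex.exp ((2 * n + 1) * z * I)

lemma nA3 (z q : ℝ) (h0 : 0 < q) (n : ℤ) : ‖A3 z q n‖ = q ^ (n ^ 2) := by
  unfold A3
  have : (2 * n * z * I : ℂ) = ((2 * n * z : ℝ) : ℂ) * I := by push_cast; ring
  rw [norm_mul, this, Complex.norm_exp_ofReal_mul_I, norm_zpow, Complex.norm_real,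
    Real.norm_of_nonneg h0.le, mul_one]

lemma nA2 (z q : ℝ) (h0 : 0 < q) (n : ℤ) : ‖A2 z q n‖ = q ^ (n * (n + 1)) := by
  unfold A2
  have : ((2 * n + 1) * z * I : ℂ) = (((2 * n + 1) * z : ℝ) : ℂ) * I := by push_cast; ring
  rw [norm_mul, this, Complex.norm_exp_ofReal_mul_I, norm_zpow, Complex.norm_real,
    Real.norm_of_nonneg h0.le, mul_one]

lemma zpow_le_aux (q : ℝ) (h0 : 0 < q) (h1 : q < 1) (e : ℤ) (n : ℕ) (h : (n : ℤ) ≤ e) :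
    q ^ e ≤ q ^ n := by
  rw [← zpow_natCast]
  exact zpow_le_zpow_right_of_le_one₀ h0 h1.le h

lemma sA3 (z q : ℝ) (h0 : 0 < q) (h1 : q < 1) : Summable fun n => ‖A3 z q n‖ := by
  have g := summable_geometric_of_lt_one h0.le h1
  apply Summable.of_nat_of_neg
  all_goals
    refine Summable.of_nonneg_of_le (fun n => norm_nonneg _) (fun n => ?_) g
    rw [nA3 z q h0]
    apply zpow_le_aux q h0 h1
    nlinarith [Int.natCast_nonneg n, Int.le_self_sq (n : ℤ)]

lemma sA2 (z q : ℝ) (h0 : 0 < q) (h1 : q < 1) : Summable fun n => ‖A2 z q n‖ := by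
  have g := summable_geometric_of_lt_one h0.le h1
  apply Summable.of_nat_of_neg_add_one
  all_goals
    refine Summable.of_nonneg_of_le (fun n => norm_nonneg _) (fun n => ?_) g
    rw [nA2 z q h0]
    apply zpow_le_aux q h0 h1
    nlinarith [Int.natCast_nonneg n]

lemma hA3 (z q : ℝ) (h0 : 0 < q) (h1 : q < 1) : ∑' n, A3 z q n = (S3 z q : ℂ) := by
  have hs := (sA3 z q h0 h1).of_norm
  have e1 := hs.hasSum
  have i1 : Function.Injective (fun n : ℕ => (n : ℤ) + 1) := fun a b h => by
    simpa using h
  have i2 : Function.Injective (fun n : ℕ => -((n : ℤ) + 1)) := fun a b h => by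
    simpa using h
  have s1 := (hs.comp_injective i1)
  have s2 := (hs.comp_injective i2)
  have e2 := HasSum.of_add_one_of_neg_add_one (f := A3 z q) s1.hasSum s2.hasSum
  rw [e2.tsum_eq]
  have e3 : (∑' n : ℕ, (A3 z q ∘ fun n : ℕ => (n : ℤ) + 1) n) +
      (∑' n : ℕ, (A3 z q ∘ fun n : ℕ => -((n : ℤ) + 1)) n) =
      2 * ((∑' n : ℕ, q ^ ((n + 1) ^ 2) * Real.cos (2 * (n + 1) * z) : ℝ) : ℂ) := by
    rw [← s1.tsum_add s2, Complex.ofReal_tsum, ← tsum_mul_left]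
    congr 1
    funext n
    simp only [Function.comp, A3]
    have x1 : (q : ℂ) ^ (((n : ℤ) + 1) ^ 2) = (q : ℂ) ^ ((n + 1) ^ 2 : ℕ) := by
      rw [← zpow_natCast]; push_cast; rfl
    have x2 : (-((n : ℤ) + 1)) ^ 2 = ((n : ℤ) + 1) ^ 2 := by ring
    rw [x2, x1]
    push_cast
    rw [Complex.cos]
    have y1 : (2 * -((n : ℂ) + 1) * z * I) = -(2 * ((n : ℂ) + 1) * z) * I := by ring
    rw [y1]
    ring
  have e4 : A3 z q 0 = 1 := by simp [A3]
  rw [e4]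
  unfold S3
  push_cast at e3 ⊢
  rw [← e3]
  ring

lemma hA2 (z q : ℝ) (h0 : 0 < q) (h1 : q < 1) : ∑' n, A2 z q n = 2 * (S2 z q : ℂ) := by
  have hs := (sA2 z q h0 h1).of_norm
  have i1 : Function.Injective (fun n : ℕ => (n : ℤ)) := fun a b h => by
    simpa using h
  have i2 : Function.Injective (fun n : ℕ => -((n : ℤ) + 1)) := fun a b h => by
    simpa using h
  have s1 := (hs.comp_injective i1)
  have s2 := (hs.comp_injective i2)
  have e2 := HasSum.of_nat_of_neg_add_one (f := A2 z q) s1.hasSum s2.hasSum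
  rw [e2.tsum_eq]
  rw [← s1.tsum_add s2, S2, Complex.ofReal_tsum, ← tsum_mul_left]
  congr 1
  funext n
  simp only [Function.comp, A2]
  have x1 : (q : ℂ) ^ ((n : ℤ) * ((n : ℤ) + 1)) = (q : ℂ) ^ (n * (n + 1) : ℕ) := by
    rw [← zpow_natCast]; push_cast; rfl
  have x2 : (-((n : ℤ) + 1)) * (-((n : ℤ) + 1) + 1) = (n : ℤ) * ((n : ℤ) + 1) := by ring
  rw [x2, x1]
  push_cast
  rw [Complex.cos]
  have y1 : ((2 * -((n : ℂ) + 1) + 1) * z * I) = -((2 * (n : ℂ) + 1) * z) * I := by ring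
  rw [y1]
  ring

/-- parity splitting map -/
def par : (ℤ × ℤ) ⊕ (ℤ × ℤ) → ℤ × ℤ
  | Sum.inl p => (p.1 + p.2, p.1 - p.2)
  | Sum.inr p => (p.1 + p.2 + 1, p.1 - p.2)

lemma par_bij : Function.Bijective par := by
  constructor
  · rintro (⟨a, b⟩ | ⟨a, b⟩) (⟨c, d⟩ | ⟨c, d⟩) h <;>
      simp only [par, Prod.mk.injEq] at h <;> obtain ⟨h1, h2⟩ := h
    · have : a = c := by omega
      have : b = d := by omega
      subst_vars; rfl
    · omega
    · omega
    · have : a = c := by omega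
      have : b = d := by omega
      subst_vars; rfl
  · rintro ⟨i, j⟩
    rcases Int.even_or_odd' (i + j) with ⟨k, hk | hk⟩
    · refine ⟨Sum.inl (k, i - k), ?_⟩
      simp only [par, Prod.mk.injEq]
      constructor <;> omega
    · refine ⟨Sum.inr (k, i - k - 1), ?_⟩
      simp only [par, Prod.mk.injEq]
      constructor <;> omega

lemma tsum_par (F : ℤ × ℤ → ℂ) (hF : Summable F) :
    ∑' p, F p = (∑' p : ℤ × ℤ, F (p.1 + p.2, p.1 - p.2)) +
      ∑' p : ℤ × ℤ, F (p.1 + p.2 + 1, p.1 - p.2) := by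
  have h := (Equiv.ofBijective par par_bij).summable_iff.2 hF
  have s1 := h.comp_injective (Sum.inl_injective (α := ℤ × ℤ) (β := ℤ × ℤ))
  have s2 := h.comp_injective (Sum.inr_injective (α := ℤ × ℤ) (β := ℤ × ℤ))
  have e := HasSum.sum s1.hasSum s2.hasSum
  rw [← (Equiv.ofBijective par par_bij).tsum_eq F]
  exact e.tsum_eq

lemma R3 (z q : ℝ) (h0 : 0 < q) (h1 : q < 1) :
    S3 z q * S3 0 q = S3 z (q ^ 2) ^ 2 + 4 * q * S2 z (q ^ 2) ^ 2 := by
  have h0' : 0 < q ^ 2 := by positivity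
  have h1' : q ^ 2 < 1 := by nlinarith
  have hq : (q : ℂ) ≠ 0 := by exact_mod_cast h0.ne'
  have hsm := summable_mul_of_summable_norm (sA3 z q h0 h1) (sA3 0 q h0 h1)
  have e := tsum_par _ hsm
  rw [← tsum_mul_tsum_of_summable_norm (sA3 z q h0 h1) (sA3 0 q h0 h1)] at e
  have f1 : (fun p : ℤ × ℤ => A3 z q (p.1 + p.2) * A3 0 q (p.1 - p.2)) =
      fun p => A3 z (q ^ 2) p.1 * A3 z (q ^ 2) p.2 := by
    funext ⟨c, d⟩
    simp only [A3]
    push_cast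
    have t1 : (2 * ((c : ℂ) + d) * z * I) = 2 * c * z * I + 2 * d * z * I := by ring
    have t2 : (2 * ((c : ℂ) - d) * 0 * I) = 0 := by ring
    rw [t1, t2, Complex.exp_add, Complex.exp_zero, ← zpow_natCast, ← zpow_mul, ← zpow_mul]
    have t3 : (q : ℂ) ^ ((c + d) ^ 2) * (q : ℂ) ^ ((c - d) ^ 2) =
        (q : ℂ) ^ (((2:ℕ):ℤ) * c ^ 2) * (q : ℂ) ^ (((2:ℕ):ℤ) * d ^ 2) := by
      rw [← zpow_add₀ hq, ← zpow_add₀ hq]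
      congr 1
      push_cast
      ring
    linear_combination (Complex.exp (2 * c * z * I) * Complex.exp (2 * d * z * I)) * t3
  have f2 : (fun p : ℤ × ℤ => A3 z q (p.1 + p.2 + 1) * A3 0 q (p.1 - p.2)) =
      fun p => (q : ℂ) * (A2 z (q ^ 2) p.1 * A2 z (q ^ 2) p.2) := by
    funext ⟨c, d⟩
    simp only [A3, A2]
    push_cast
    have t1 : (2 * ((c : ℂ) + d + 1) * z * I) = (2 * c + 1) * z * I + (2 * d + 1) * z * I := by ring
    have t2 : (2 * ((c : ℂ) - d) * 0 * I) = 0 := by ring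
    rw [t1, t2, Complex.exp_add, Complex.exp_zero, ← zpow_natCast, ← zpow_mul, ← zpow_mul]
    have t3 : (q : ℂ) ^ ((c + d + 1) ^ 2) * (q : ℂ) ^ ((c - d) ^ 2) =
        q * ((q : ℂ) ^ (((2:ℕ):ℤ) * (c * (c + 1))) * (q : ℂ) ^ (((2:ℕ):ℤ) * (d * (d + 1)))) := by
      rw [← zpow_add₀ hq, ← zpow_add₀ hq, ← zpow_one_add₀ hq]
      congr 1
      push_cast
      ring
    linear_combination (Complex.exp ((2 * c + 1) * z * I) * Complex.exp ((2 * d + 1) * z * I)) * t3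
  simp only [f1, f2] at e
  rw [tsum_mul_left, ← tsum_mul_tsum_of_summable_norm (sA3 z _ h0' h1') (sA3 z _ h0' h1'),
    ← tsum_mul_tsum_of_summable_norm (sA2 z _ h0' h1') (sA2 z _ h0' h1'),
    hA3 z q h0 h1, hA3 0 q h0 h1, hA3 z _ h0' h1', hA2 z _ h0' h1'] at e
  have e' : ((S3 z q * S3 0 q : ℝ) : ℂ) =
      ((S3 z (q ^ 2) ^ 2 + 4 * q * S2 z (q ^ 2) ^ 2 : ℝ) : ℂ) := by
    push_cast
    rw [e]
    ring
  exact_mod_cast e'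

lemma R2 (z q : ℝ) (h0 : 0 < q) (h1 : q < 1) :
    S2 z q * S2 0 q = S2 z (q ^ 2) * S3 z (q ^ 2) := by
  have h0' : 0 < q ^ 2 := by positivity
  have h1' : q ^ 2 < 1 := by nlinarith
  have hq : (q : ℂ) ≠ 0 := by exact_mod_cast h0.ne'
  have hsm := summable_mul_of_summable_norm (sA2 z q h0 h1) (sA2 0 q h0 h1)
  have e := tsum_par _ hsm
  rw [← tsum_mul_tsum_of_summable_norm (sA2 z q h0 h1) (sA2 0 q h0 h1)] at e
  have f1 : (fun p : ℤ × ℤ => A2 z q (p.1 + p.2) * A2 0 q (p.1 - p.2)) =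
      fun p => A2 z (q ^ 2) p.1 * A3 z (q ^ 2) p.2 := by
    funext ⟨c, d⟩
    simp only [A3, A2]
    push_cast
    have t1 : ((2 * ((c : ℂ) + d) + 1) * z * I) = (2 * c + 1) * z * I + 2 * d * z * I := by ring
    have t2 : ((2 * ((c : ℂ) - d) + 1) * 0 * I) = 0 := by ring
    rw [t1, t2, Complex.exp_add, Complex.exp_zero, ← zpow_natCast, ← zpow_mul, ← zpow_mul]
    have t3 : (q : ℂ) ^ ((c + d) * (c + d + 1)) * (q : ℂ) ^ ((c - d) * (c - d + 1)) =
        (q : ℂ) ^ (((2:ℕ):ℤ) * (c * (c + 1))) * (q : ℂ) ^ (((2:ℕ):ℤ) * d ^ 2) := by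
      rw [← zpow_add₀ hq, ← zpow_add₀ hq]
      congr 1
      push_cast
      ring
    linear_combination (Complex.exp ((2 * c + 1) * z * I) * Complex.exp (2 * d * z * I)) * t3
  have f2 : (fun p : ℤ × ℤ => A2 z q (p.1 + p.2 + 1) * A2 0 q (p.1 - p.2)) =
      fun p => A3 z (q ^ 2) (p.1 + 1) * A2 z (q ^ 2) p.2 := by
    funext ⟨c, d⟩
    simp only [A3, A2]
    push_cast
    have t1 : ((2 * ((c : ℂ) + d + 1) + 1) * z * I) =
      2 * (c + 1) * z * I + (2 * d + 1) * z * I := by ring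
    have t2 : ((2 * ((c : ℂ) - d) + 1) * 0 * I) = 0 := by ring
    rw [t1, t2, Complex.exp_add, Complex.exp_zero, ← zpow_natCast, ← zpow_mul, ← zpow_mul]
    have t3 : (q : ℂ) ^ ((c + d + 1) * (c + d + 1 + 1)) * (q : ℂ) ^ ((c - d) * (c - d + 1)) =
        (q : ℂ) ^ (((2:ℕ):ℤ) * (c + 1) ^ 2) * (q : ℂ) ^ (((2:ℕ):ℤ) * (d * (d + 1))) := by
      rw [← zpow_add₀ hq, ← zpow_add₀ hq]
      congr 1
      push_cast
      ring
    linear_combination (Complex.exp (2 * (c + 1) * z * I) * Complex.exp ((2 * d + 1) * z * I)) * t3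
  simp only [f1, f2] at e
  have sh : Summable fun n : ℤ => ‖A3 z (q ^ 2) (n + 1)‖ :=
    (sA3 z _ h0' h1').comp_injective (add_left_injective 1)
  have sh2 : ∑' n : ℤ, A3 z (q ^ 2) (n + 1) = ∑' n : ℤ, A3 z (q ^ 2) n :=
    (Equiv.addRight (1 : ℤ)).tsum_eq (A3 z (q ^ 2))
  rw [← tsum_mul_tsum_of_summable_norm (sA2 z _ h0' h1') (sA3 z _ h0' h1'),
    ← tsum_mul_tsum_of_summable_norm sh (sA2 z _ h0' h1'), sh2,
    hA2 z q h0 h1, hA2 0 q h0 h1, hA3 z _ h0' h1', hA2 z _ h0' h1'] at e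
  have e' : ((S2 z q * S2 0 q : ℝ) : ℂ) =
      ((S2 z (q ^ 2) * S3 z (q ^ 2) : ℝ) : ℂ) := by
    push_cast
    linear_combination e / 4
  exact_mod_cast e'

lemma pow_tendsto (q : ℝ) (h0 : 0 < q) (h1 : q < 1) :
    Tendsto (fun n : ℕ => q ^ (2 ^ n)) atTop (nhdsWithin 0 (Ioi 0)) := by
  rw [tendsto_nhdsWithin_iff]
  constructor
  · exact (tendsto_pow_atTop_nhds_zero_of_lt_one h0.le h1).comp
      (tendsto_pow_atTop_atTop_of_one_lt (by norm_num))
  · exact Eventually.of_forall fun n => by simp only [mem_Ioi]; positivity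

lemma climb (P : ℝ → Prop) (hev : ∀ᶠ q in nhdsWithin 0 (Ioi 0), P q)
    (hstep : ∀ q, 0 < q → q < 1 → P (q ^ 2) → P q) (q : ℝ) (h0 : 0 < q) (h1 : q < 1) : P q := by
  obtain ⟨n, hn⟩ := ((pow_tendsto q h0 h1).eventually hev).exists
  induction n generalizing q with
  | zero => simpa using hn
  | succ n ih =>
    apply hstep q h0 h1
    apply ih (q ^ 2) (by positivity) (by nlinarith)
    rw [← pow_mul]
    rwa [pow_succ, mul_comm] at hn

lemma S3_pos (z q : ℝ) (h0 : 0 < q) (h1 : q < 1) : 0 < S3 z q := by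
  refine climb (fun q => 0 < S3 z q) ?_ ?_ q h0 h1
  · exact (S3_tendsto z).eventually (lt_mem_nhds one_pos)
  · intro q h0 h1 h
    have e := R3 z q h0 h1
    have p := S3_zero_pos q h0.le
    have : 0 < S3 z q * S3 0 q := by rw [e]; positivity
    exact pos_of_mul_pos_left this p.le

lemma S2_pos (z q : ℝ) (hz : 0 < Real.cos z) (h0 : 0 < q) (h1 : q < 1) : 0 < S2 z q := by
  refine climb (fun q => 0 < S2 z q) ?_ ?_ q h0 h1
  · exact (S2_tendsto z).eventually (lt_mem_nhds hz)
  · intro q h0 h1 h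
    have e := R2 z q h0 h1
    have p := S2_zero_pos q h0.le h1
    have p3 := S3_pos z (q ^ 2) (by positivity) (by nlinarith)
    have : 0 < S2 z q * S2 0 q := by rw [e]; positivity
    exact pos_of_mul_pos_left this p.le

/-- the dc function -/
def DD (z q : ℝ) : ℝ := (S2 0 q / S2 z q) * (S3 z q / S3 0 q)

/-- the modulus at the squared nome -/
def cc (q : ℝ) : ℝ := 4 * q * (S2 0 (q ^ 2) / S3 0 (q ^ 2)) ^ 2

lemma DD_pos (z q : ℝ) (hz : 0 < Real.cos z) (h0 : 0 < q) (h1 : q < 1) : 0 < DD z q := by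
  have a := S2_pos z q hz h0 h1
  have b := S3_pos z q h0 h1
  have c := S2_zero_pos q h0.le h1
  have d := S3_zero_pos q h0.le
  unfold DD
  positivity

lemma cc_pos (q : ℝ) (h0 : 0 < q) (h1 : q < 1) : 0 < cc q := by
  have c := S2_zero_pos (q ^ 2) (by positivity) (by nlinarith)
  have d := S3_zero_pos (q ^ 2) (by positivity)
  unfold cc
  positivity

lemma DD_rec (z q : ℝ) (hz : 0 < Real.cos z) (h0 : 0 < q) (h1 : q < 1) :
    DD z q = (DD z (q ^ 2) + cc q / DD z (q ^ 2)) / (1 + cc q) := by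
  have h0' : 0 < q ^ 2 := by positivity
  have h1' : q ^ 2 < 1 := by nlinarith
  have ha := S2_pos z _ hz h0' h1'
  have hb := S3_pos z _ h0' h1'
  have ha0 := S2_zero_pos _ h0'.le h1'
  have hb0 := S3_zero_pos _ h0'.le
  have hx := S2_pos z _ hz h0 h1
  have hy := S3_pos z _ h0 h1
  have hx0 := S2_zero_pos _ h0.le h1
  have hy0 := S3_zero_pos _ h0.le
  have r3 := R3 z q h0 h1
  have r2 := R2 z q h0 h1
  have r30 := R3 0 q h0 h1
  have r20 := R2 0 q h0 h1
  unfold DD cc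
  generalize S2 z (q ^ 2) = a at *
  generalize S3 z (q ^ 2) = b at *
  generalize S2 0 (q ^ 2) = a0 at *
  generalize S3 0 (q ^ 2) = b0 at *
  generalize S2 z q = x at *
  generalize S3 z q = y at *
  generalize S2 0 q = x0 at *
  generalize S3 0 q = y0 at *
  have e1 : x0 / x * (y / y0) = (x0 * x0) * (y * y0) / ((x * x0) * (y0 * y0)) := by
    field_simp
  rw [e1, r3, r2, r30, r20]
  have : 0 < b0 ^ 2 + 4 * q * a0 ^ 2 := by positivity
  field_simp

lemma cc_rec (q : ℝ) (h0 : 0 < q) (h1 : q < 1) :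
    cc q ^ 2 * (1 + cc (q ^ 2)) ^ 2 = 4 * cc (q ^ 2) := by
  have h0' : 0 < q ^ 2 := by positivity
  have h1' : q ^ 2 < 1 := by nlinarith
  have h0'' : 0 < (q ^ 2) ^ 2 := by positivity
  have h1'' : (q ^ 2) ^ 2 < 1 := by nlinarith
  have ha0 := S2_zero_pos _ h0''.le h1''
  have hb0 := S3_zero_pos _ h0''.le
  have hx0 := S2_zero_pos _ h0'.le h1'
  have hy0 := S3_zero_pos _ h0'.le
  have r30 := R3 0 _ h0' h1'
  have r20 := R2 0 _ h0' h1'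
  unfold cc
  generalize S2 0 ((q ^ 2) ^ 2) = a0 at *
  generalize S3 0 ((q ^ 2) ^ 2) = b0 at *
  generalize S2 0 (q ^ 2) = x0 at *
  generalize S3 0 (q ^ 2) = y0 at *
  have e1 : (x0 / y0) ^ 2 = (x0 * x0) / (y0 * y0) := by
    field_simp
  rw [e1, r30, r20]
  have : 0 < b0 ^ 2 + 4 * q ^ 2 * a0 ^ 2 := by positivity
  field_simp

lemma sq_tendsto_zero : Tendsto (fun q : ℝ => q ^ 2) (nhdsWithin 0 (Ioi 0)) (nhdsWithin 0 (Ioi 0)) := by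
  rw [tendsto_nhdsWithin_iff]
  constructor
  · have : ContinuousAt (fun q : ℝ => q ^ 2) 0 := by fun_prop
    have := this.tendsto
    norm_num at this
    exact this.mono_left nhdsWithin_le_nhds
  · filter_upwards [self_mem_nhdsWithin] with q hq
    simp only [mem_Ioi] at *
    positivity

lemma g_tendsto : Tendsto (fun q : ℝ => (S2 0 (q ^ 2) / S3 0 (q ^ 2)) ^ 2)
    (nhdsWithin 0 (Ioi 0)) (nhds 1) := by
  have h := (((S2_tendsto 0).div (S3_tendsto 0) one_ne_zero).pow 2).comp sq_tendsto_zero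
  simp only [Real.cos_zero, div_one, one_pow] at h
  exact h

lemma cc_tendsto : Tendsto cc (nhdsWithin 0 (Ioi 0)) (nhds 0) := by
  have h : Tendsto (fun q : ℝ => 4 * q) (nhdsWithin 0 (Ioi 0)) (nhds 0) := by
    have : ContinuousAt (fun q : ℝ => 4 * q) 0 := by fun_prop
    have := this.tendsto
    norm_num at this
    exact this.mono_left nhdsWithin_le_nhds
  have := h.mul g_tendsto
  rw [zero_mul] at this
  exact this

lemma cc_lt_one (q : ℝ) (h0 : 0 < q) (h1 : q < 1) : cc q < 1 := by
  refine climb (fun q => cc q < 1) ?_ ?_ q h0 h1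
  · exact cc_tendsto.eventually (gt_mem_nhds one_pos)
  · intro q h0 h1 h
    have r := cc_rec q h0 h1
    have p := cc_pos q h0 h1
    have p' := cc_pos (q ^ 2) (by positivity) (by nlinarith)
    by_contra hc
    have hc : 1 ≤ cc q := not_lt.1 hc
    have : 1 ≤ cc q ^ 2 := by nlinarith
    have h3 : 0 < (1 - cc (q ^ 2)) ^ 2 := by
      have : 0 < 1 - cc (q ^ 2) := by linarith
      positivity
    nlinarith [mul_le_mul_of_nonneg_right this (sq_nonneg (1 + cc (q ^ 2)))]

lemma cc_step (a b : ℝ) (a0 : 0 < a) (b0 : 0 < b) (b1 : b < 1) (a1 : a < 1)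
    (h : cc (a ^ 2) < cc (b ^ 2)) : cc a < cc b := by
  have ra := cc_rec a a0 a1
  have rb := cc_rec b b0 b1
  have pa := cc_pos a a0 a1
  have pb := cc_pos b b0 b1
  have pa' := cc_pos (a ^ 2) (by positivity) (by nlinarith)
  have pb' := cc_pos (b ^ 2) (by positivity) (by nlinarith)
  have lb := cc_lt_one (b ^ 2) (by positivity) (by nlinarith)
  generalize cc a = x at *
  generalize cc b = y at *
  generalize cc (a ^ 2) = s at *
  generalize cc (b ^ 2) = t at *
  have ex : x ^ 2 = 4 * s / (1 + s) ^ 2 := by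
    rw [eq_div_iff (by positivity)]; exact ra
  have ey : y ^ 2 = 4 * t / (1 + t) ^ 2 := by
    rw [eq_div_iff (by positivity)]; exact rb
  have : x ^ 2 < y ^ 2 := by
    rw [ex, ey, div_lt_div_iff₀ (by positivity) (by positivity)]
    have h1 : 0 < (t - s) * (1 - s * t) := by
      apply mul_pos
      · linarith
      · nlinarith
    nlinarith
  exact lt_of_pow_lt_pow_left₀ 2 pb.le this

lemma cc_climb (n : ℕ) (a b : ℝ) (a0 : 0 < a) (hab : a < b) (b1 : b < 1)
    (h : cc (a ^ (2 ^ n)) < cc (b ^ (2 ^ n))) : cc a < cc b := by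
  induction n generalizing a b with
  | zero => simpa using h
  | succ n ih =>
    have h2 : a ^ 2 < b ^ 2 := by nlinarith
    apply cc_step a b a0 (by linarith) b1 (by linarith)
    apply ih (a ^ 2) (b ^ 2) (by positivity) h2 (by nlinarith)
    rw [← pow_mul, ← pow_mul]
    rwa [pow_succ, mul_comm] at h

lemma cc_lt (a b : ℝ) (a0 : 0 < a) (hab : a < b) (b1 : b < 1) : cc a < cc b := by
  have b0 : 0 < b := by linarith
  have ev : ∀ᶠ q in nhdsWithin (0:ℝ) (Ioi 0), 2 * q < cc q ∧ cc q < 8 * q := by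
    filter_upwards [g_tendsto.eventually (lt_mem_nhds (show (1/2:ℝ) < 1 by norm_num)),
      g_tendsto.eventually (gt_mem_nhds (show (1:ℝ) < 2 by norm_num)), self_mem_nhdsWithin]
      with q h1 h2 hq
    have hq : 0 < q := hq
    unfold cc
    constructor <;> nlinarith
  have e1 := (pow_tendsto a a0 (by linarith)).eventually ev
  have e2 := (pow_tendsto b b0 b1).eventually ev
  have r1 : a / b < 1 := by rwa [div_lt_one b0]
  have e3 := ((pow_tendsto (a / b) (by positivity) r1).mono_right nhdsWithin_le_nhds).eventually
    (gt_mem_nhds (show (0:ℝ) < 1/4 by norm_num))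
  obtain ⟨n, h1, h2, h3⟩ := (e1.and (e2.and e3)).exists
  apply cc_climb n a b a0 hab b1
  rw [div_pow, div_lt_iff₀ (by positivity)] at h3
  linarith [h1.2, h2.1]

lemma DD_tendsto (z : ℝ) (hz : 0 < Real.cos z) :
    Tendsto (DD z) (nhdsWithin 0 (Ioi 0)) (nhds (1 / Real.cos z)) := by
  have h := ((S2_tendsto 0).div (S2_tendsto z) hz.ne').mul
    ((S3_tendsto z).div (S3_tendsto 0) one_ne_zero)
  simp only [Real.cos_zero, div_one, mul_one] at h
  exact h

lemma DD_gt_one (z q : ℝ) (hz : 0 < Real.cos z) (hz1 : Real.cos z < 1) (h0 : 0 < q) (h1 : q < 1) :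
    1 < DD z q := by
  refine climb (fun q => 1 < DD z q) ?_ ?_ q h0 h1
  · exact (DD_tendsto z hz).eventually (lt_mem_nhds ((one_lt_div hz).2 hz1))
  · intro q h0 h1 h
    have r := DD_rec z q hz h0 h1
    have p := cc_pos q h0 h1
    have l := cc_lt_one q h0 h1
    show 1 < DD z q
    rw [r, lt_div_iff₀ (by positivity), ← sub_pos]
    have hd : 0 < DD z (q ^ 2) := by linarith
    have : DD z (q ^ 2) + cc q / DD z (q ^ 2) - 1 * (1 + cc q) =
      (DD z (q ^ 2) - 1) * (DD z (q ^ 2) - cc q) / DD z (q ^ 2) := by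
      field_simp
      ring
    rw [this]
    apply div_pos _ hd
    apply mul_pos <;> linarith

/-- monotonicity of the Landen map in the modulus -/
lemma f_c (D c c' : ℝ) (hD : 1 < D) (h0 : 0 < c) (h : c < c') :
    (D + c' / D) / (1 + c') < (D + c / D) / (1 + c) := by
  have d0 : 0 < D := by linarith
  have c0 : 0 < c' := by linarith
  rw [div_lt_div_iff₀ (by positivity) (by positivity), ← sub_pos]
  have : (D + c / D) * (1 + c') - (D + c' / D) * (1 + c) = (c' - c) * (D ^ 2 - 1) / D := by
    field_simp
    ring
  rw [this]
  apply div_pos _ d0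
  apply mul_pos <;> nlinarith

/-- Lipschitz bound of the Landen map -/
lemma f_D (D D' c : ℝ) (hD : 1 < D) (hD' : 1 < D') (h0 : 0 < c) (h1 : c < 1) :
    (D + c / D) / (1 + c) - (D' + c / D') / (1 + c) ≤ max 0 (D - D') := by
  have d0 : 0 < D := by linarith
  have d0' : 0 < D' := by linarith
  have e : (D + c / D) / (1 + c) - (D' + c / D') / (1 + c) =
      (D - D') * ((1 - c / (D * D')) / (1 + c)) := by
    field_simp
    ring
  have hDD : 1 < D * D' := by nlinarith
  have k1 : c / (D * D') ≤ 1 := by rw [div_le_one (by positivity)]; linarith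
  have k0 : 0 < c / (D * D') := by positivity
  have l0 : 0 ≤ (1 - c / (D * D')) / (1 + c) := div_nonneg (by linarith) (by linarith)
  have l1 : (1 - c / (D * D')) / (1 + c) ≤ 1 := by rw [div_le_one (by linarith)]; linarith
  rw [e]
  rcases le_total D D' with h | h
  · exact le_max_of_le_left (mul_nonpos_of_nonpos_of_nonneg (by linarith) l0)
  · exact le_max_of_le_right (mul_le_of_le_one_right (by linarith) l1)

lemma DD_step (z a b : ℝ) (hz : 0 < Real.cos z) (hz1 : Real.cos z < 1) (a0 : 0 < a) (hab : a < b)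
    (b1 : b < 1) : DD z b - DD z a < max 0 (DD z (b ^ 2) - DD z (a ^ 2)) := by
  have b0 : 0 < b := by linarith
  have a1 : a < 1 := by linarith
  have ga := DD_gt_one z (a ^ 2) hz hz1 (by positivity) (by nlinarith)
  have gb := DD_gt_one z (b ^ 2) hz hz1 (by positivity) (by nlinarith)
  rw [DD_rec z a hz a0 a1, DD_rec z b hz b0 b1]
  have h1 := f_c (DD z (a ^ 2)) (cc a) (cc b) ga (cc_pos a a0 a1) (cc_lt a b a0 hab b1)
  have h2 := f_D (DD z (b ^ 2)) (DD z (a ^ 2)) (cc b) gb ga (cc_pos b b0 b1) (cc_lt_one b b0 b1)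
  linarith

lemma DD_climb (z : ℝ) (hz : 0 < Real.cos z) (hz1 : Real.cos z < 1) (n : ℕ) (a b : ℝ) (a0 : 0 < a)
    (hab : a < b) (b1 : b < 1) :
    DD z b - DD z a ≤ max 0 (DD z (b ^ (2 ^ n)) - DD z (a ^ (2 ^ n))) := by
  induction n generalizing a b with
  | zero => simp
  | succ n ih =>
    have h := DD_step z a b hz hz1 a0 hab b1
    have h2 : a ^ 2 < b ^ 2 := by nlinarith
    have := ih (a ^ 2) (b ^ 2) (by positivity) h2 (by nlinarith)
    rw [← pow_mul, ← pow_mul] at this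
    rw [pow_succ, mul_comm]
    refine h.le.trans (max_le (le_max_left _ _) this)

lemma DD_anti (z a b : ℝ) (hz : 0 < Real.cos z) (hz1 : Real.cos z < 1) (a0 : 0 < a)
    (hab : a < b) (b1 : b < 1) : DD z b ≤ DD z a := by
  have h1 := (DD_tendsto z hz).comp (pow_tendsto a a0 (by linarith))
  have h2 := (DD_tendsto z hz).comp (pow_tendsto b (by linarith) b1)
  have h3 := (tendsto_const_nhds (x := (0:ℝ))).max (h2.sub h1)
  simp only [sub_self, max_self] at h3
  have := ge_of_tendsto' h3 (fun n => DD_climb z hz hz1 n a b a0 hab b1)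
  linarith

lemma DD_lt (z a b : ℝ) (hz : 0 < Real.cos z) (hz1 : Real.cos z < 1) (a0 : 0 < a)
    (hab : a < b) (b1 : b < 1) : DD z b < DD z a := by
  have h := DD_step z a b hz hz1 a0 hab b1
  have h2 := DD_anti z (a ^ 2) (b ^ 2) hz hz1 (by positivity) (by nlinarith) (by nlinarith)
  rw [max_eq_left (by linarith)] at h
  linarith

lemma sq_tendsto_one : Tendsto (fun q : ℝ => q ^ 2) (nhdsWithin 1 (Iio 1)) (nhdsWithin 1 (Iio 1)) := by
  rw [tendsto_nhdsWithin_iff]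
  constructor
  · have : ContinuousAt (fun q : ℝ => q ^ 2) 1 := by fun_prop
    have := this.tendsto
    norm_num at this
    exact this.mono_left nhdsWithin_le_nhds
  · filter_upwards [Ioo_mem_nhdsLT (show (0:ℝ) < 1 by norm_num)] with q hq
    simp only [mem_Iio, mem_Ioo] at *
    nlinarith

lemma ev_Ioo : ∀ᶠ q in nhdsWithin (1:ℝ) (Iio 1), q ∈ Ioo (0:ℝ) 1 := Ioo_mem_nhdsLT one_pos

lemma cc_tendsto_one : Tendsto cc (nhdsWithin 1 (Iio 1)) (nhds 1) := by
  have hm : MonotoneOn cc (Ioo 0 1) := by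
    intro a ha b hb hab
    rcases eq_or_lt_of_le hab with rfl | hab
    · rfl
    · exact (cc_lt a b ha.1 hab hb.2).le
  have ht := hm.tendsto_nhdsWithin_Ioo_left ⟨1/2, by norm_num⟩
    ⟨1, by rintro _ ⟨q, hq, rfl⟩; exact (cc_lt_one q hq.1 hq.2).le⟩
  generalize sSup (cc '' Ioo 0 1) = l at ht
  have hl : 0 < l := by
    have : cc (1/2) ≤ l := by
      refine ge_of_tendsto ht ?_
      filter_upwards [Ioo_mem_nhdsLT (show (1/2:ℝ) < 1 by norm_num)] with q hq
      exact (cc_lt _ _ (by norm_num) hq.1 hq.2).le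
    exact (cc_pos _ (by norm_num) (by norm_num)).trans_le this
  have h2 := ht.comp sq_tendsto_one
  have e1 := (ht.pow 2).mul ((h2.const_add 1).pow 2)
  have e2 := h2.const_mul 4
  have e : l ^ 2 * (1 + l) ^ 2 = 4 * l := by
    refine tendsto_nhds_unique (e1.congr' ?_) e2
    filter_upwards [ev_Ioo] with q hq
    exact cc_rec q hq.1 hq.2
  have : l = 1 := by
    have h3 : l * ((l - 1) * (l ^ 2 + 3 * l + 4)) = 0 := by linear_combination e
    have h4 : 0 < l ^ 2 + 3 * l + 4 := by positivity
    rcases mul_eq_zero.1 h3 with h | h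
    · linarith
    · rcases mul_eq_zero.1 h with h | h <;> linarith
  rwa [this] at ht

lemma DD_tendsto_one (z : ℝ) (hz : 0 < Real.cos z) (hz1 : Real.cos z < 1) :
    Tendsto (DD z) (nhdsWithin 1 (Iio 1)) (nhds 1) := by
  have hm : MonotoneOn (fun q => - DD z q) (Ioo 0 1) := by
    intro a ha b hb hab
    rcases eq_or_lt_of_le hab with rfl | hab
    · rfl
    · exact neg_le_neg (DD_lt z a b hz hz1 ha.1 hab hb.2).le
  have ht' := hm.tendsto_nhdsWithin_Ioo_left ⟨1/2, by norm_num⟩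
    ⟨-1, by rintro _ ⟨q, hq, rfl⟩; exact neg_le_neg (DD_gt_one z q hz hz1 hq.1 hq.2).le⟩
  have ht := ht'.neg
  simp only [neg_neg] at ht
  generalize -sSup ((fun q => - DD z q) '' Ioo 0 1) = l at ht
  have hl : 1 ≤ l := by
    refine ge_of_tendsto ht ?_
    filter_upwards [ev_Ioo] with q hq
    exact (DD_gt_one z q hz hz1 hq.1 hq.2).le
  have h2 := ht.comp sq_tendsto_one
  have e1 := (h2.add (cc_tendsto_one.div h2 (by linarith))).div (cc_tendsto_one.const_add 1)
    (by norm_num)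
  have e : (l + 1 / l) / (1 + 1) = l := by
    refine tendsto_nhds_unique (e1.congr' ?_) ht
    filter_upwards [ev_Ioo] with q hq
    exact (DD_rec z q hz hq.1 hq.2).symm
  have : l = 1 := by
    field_simp at e
    nlinarith
  rwa [this] at ht

lemma DD_cont (z q : ℝ) (hz : 0 < Real.cos z) (h0 : 0 < q) (h1 : q < 1) :
    ContinuousAt (DD z) q := by
  unfold DD
  exact ((S2_cont 0 q h0 h1).div (S2_cont z q h0 h1) (S2_pos z q hz h0 h1).ne').mul
    ((S3_cont z q h0 h1).div (S3_cont 0 q h0 h1) (S3_zero_pos q h0.le).ne')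

lemma theta2_eq (z q : ℝ) (h0 : 0 < q) :
    theta2 (z : ℂ) (q : ℂ) = ((2 * q ^ (1/4 : ℝ) * S2 z q : ℝ) : ℂ) := by
  have hq : (q : ℂ) ≠ 0 := by exact_mod_cast h0.ne'
  unfold theta2 S2
  push_cast
  rw [mul_assoc]
  congr 1
  rw [← tsum_mul_left]
  congr 1
  funext n
  rw [Complex.ofReal_cpow h0.le, ← mul_assoc]
  congr 1
  rw [← Complex.cpow_natCast (q : ℂ) (n * (n + 1)), ← Complex.cpow_add _ _ hq]
  congr 1
  push_cast
  ring

lemma theta3_eq (z q : ℝ) : theta3 (z : ℂ) (q : ℂ) = ((S3 z q : ℝ) : ℂ) := by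
  unfold theta3 S3
  push_cast
  rfl

lemma theta4_eq (z q : ℝ) : theta4 (z : ℂ) (q : ℂ) = ((S3 (z + Real.pi / 2) q : ℝ) : ℂ) := by
  have h : S3 (z + Real.pi / 2) q =
      1 + 2 * ∑' n : ℕ, (-1) ^ (n + 1) * q ^ ((n + 1) ^ 2) * Real.cos (2 * (n + 1) * z) := by
    unfold S3
    congr 3
    funext n
    have : 2 * ((n : ℝ) + 1) * (z + Real.pi / 2) =
      2 * ((n : ℝ) + 1) * z + ((n + 1 : ℕ) : ℝ) * Real.pi := by push_cast; ring
    rw [this, Real.cos_add_nat_mul_pi]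
    ring
  rw [h]
  unfold theta4
  push_cast
  rfl

lemma dc_eq (u m : ℝ) (h0 : 0 < m) (h1 : m < 1) (hu : 0 < Real.cos (Real.pi * u / 2)) :
    dnR (KR m * u) m / cnR (KR m * u) m = DD (Real.pi * u / 2) (qr m) := by
  have hK := Kr_pos m h0.le h1
  have e1 : KR m = Kr m := by unfold KR; rw [ellK_eq m h1]; simp
  have q0 := qr_pos m
  have q1 := qr_lt_one m h0 h1
  have harg : (Real.pi : ℂ) * ((KR m * u : ℝ) : ℂ) / (2 * ellK m) =
      ((Real.pi * u / 2 : ℝ) : ℂ) := by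
    rw [ellK_eq m h1, e1]
    have : ((Kr m : ℝ) : ℂ) ≠ 0 := by exact_mod_cast hK.ne'
    push_cast
    field_simp
  have z0 : (0 : ℂ) = ((0 : ℝ) : ℂ) := by simp
  unfold dnR cnR dn cn
  rw [harg, nome_eq m h0 h1, z0]
  simp only [theta2_eq _ _ q0, theta3_eq, theta4_eq]
  have a := S2_pos _ _ hu q0 q1
  have b := S3_pos (Real.pi * u / 2) _ q0 q1
  have c := S2_zero_pos _ q0.le q1
  have d := S3_zero_pos _ q0.le
  have e := S3_pos (0 + Real.pi / 2) _ q0 q1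
  have f := S3_pos (Real.pi * u / 2 + Real.pi / 2) _ q0 q1
  have g : 0 < (qr m) ^ (1/4 : ℝ) := Real.rpow_pos_of_pos q0 _
  simp only [← Complex.ofReal_div, ← Complex.ofReal_mul, Complex.ofReal_re]
  unfold DD
  generalize S3 (0 + Real.pi / 2) (qr m) = s at *
  generalize S3 (Real.pi * u / 2 + Real.pi / 2) (qr m) = t at *
  field_simp

lemma phi_eq (u m : ℝ) (h0 : 0 < m) (h1 : m < 1) (hu : 0 < Real.cos (Real.pi * u / 2)) :
    phi u m = DD (Real.pi * u / 2) (qr (1 - m)) ^ 2 - DD (Real.pi * u / 2) (qr m) ^ 2 := by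
  unfold phi
  rw [dc_eq u m h0 h1 hu, dc_eq u (1 - m) (by linarith) (by linarith) hu]

/-- For `u ∈ (1/2,1)`, there is a unique `μ̃ ∈ (0,1)` with
`φ(u,μ̃) = 1`; moreover `μ̃ ∈ (1/2,1)`, and `φ(u,μ) < 1` for `μ < μ̃` while
`φ(u,μ) > 1` for `μ > μ̃` (μ ranging in `(0,1)`). -/
theorem phi_unique_solution (u : ℝ) (hu : u ∈ Set.Ioo (1 / 2 : ℝ) 1) :
    ∃ μt : ℝ, μt ∈ Set.Ioo (1 / 2 : ℝ) 1 ∧ phi u μt = 1 ∧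
      (∀ μ ∈ Set.Ioo (0 : ℝ) 1, phi u μ = 1 → μ = μt) ∧
      (∀ μ ∈ Set.Ioo (0 : ℝ) 1, μ < μt → phi u μ < 1) ∧
      (∀ μ ∈ Set.Ioo (0 : ℝ) 1, μt < μ → 1 < phi u μ) := by
  obtain ⟨hu0, hu1⟩ := hu
  have hpi := Real.pi_pos
  have hz : 0 < Real.cos (Real.pi * u / 2) := by
    apply Real.cos_pos_of_mem_Ioo
    constructor <;> nlinarith
  have hlt : Real.cos (Real.pi * u / 2) < Real.cos (Real.pi / 4) := by
    apply Real.cos_lt_cos_of_nonneg_of_le_pi_div_two <;> nlinarith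
  have hsq : Real.cos (Real.pi * u / 2) ^ 2 < 1 / 2 := by
    have h2 : Real.cos (Real.pi / 4) ^ 2 = 1 / 2 := by
      rw [Real.cos_pi_div_four, div_pow, Real.sq_sqrt (by norm_num)]; norm_num
    rw [← h2]
    exact pow_lt_pow_left₀ hlt hz.le two_ne_zero
  have hz1 : Real.cos (Real.pi * u / 2) < 1 := by nlinarith
  have hphi := fun m (hm : m ∈ Ioo (0:ℝ) 1) => phi_eq u m hm.1 hm.2 hz
  generalize Real.pi * u / 2 = z at *
  have mono : ∀ m ∈ Ioo (0:ℝ) 1, ∀ n ∈ Ioo (0:ℝ) 1, m < n → phi u m < phi u n := by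
    intro m hm n hn hmn
    rw [hphi m hm, hphi n hn]
    have q1 := qr_lt m n hm.1 hmn hn.2
    have q2 := qr_lt (1 - n) (1 - m) (by linarith [hn.2]) (by linarith) (by linarith [hm.1])
    have q3 := qr_lt_one n hn.1 hn.2
    have q4 := qr_lt_one (1 - m) (by linarith [hm.2]) (by linarith [hm.1])
    have d1 := DD_lt z _ _ hz hz1 (qr_pos m) q1 q3
    have d2 := DD_lt z _ _ hz hz1 (qr_pos (1 - n)) q2 q4
    have p1 := DD_pos z _ hz (qr_pos n) q3
    have p2 := DD_pos z _ hz (qr_pos (1 - m)) q4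
    nlinarith
  have cont : ∀ m ∈ Ioo (0:ℝ) 1, ContinuousAt (phi u) m := by
    intro m hm
    have c1 : ContinuousAt (fun m => DD z (qr m)) m :=
      ContinuousAt.comp (g := DD z) (DD_cont z _ hz (qr_pos m) (qr_lt_one m hm.1 hm.2))
        (qr_cont m hm.1 hm.2)
    have hm' : 1 - m ∈ Ioo (0:ℝ) 1 := ⟨by linarith [hm.2], by linarith [hm.1]⟩
    have c0 : ContinuousAt (fun m => qr (1 - m)) m :=
      ContinuousAt.comp (g := qr) (qr_cont (1 - m) hm'.1 hm'.2) (by fun_prop)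
    have c2 : ContinuousAt (fun m => DD z (qr (1 - m))) m :=
      ContinuousAt.comp (g := DD z) (DD_cont z _ hz (qr_pos _) (qr_lt_one _ hm'.1 hm'.2)) c0
    refine ((c2.pow 2).sub (c1.pow 2)).congr ?_
    filter_upwards [Ioo_mem_nhds hm.1 hm.2] with x hx
    exact (hphi x hx).symm
  have lim : Tendsto (phi u) (nhdsWithin 1 (Iio 1)) (nhds ((1 / Real.cos z) ^ 2 - 1 ^ 2)) := by
    have t1 := ((DD_tendsto z hz).comp qr_tendsto_zero).pow 2
    have t2 := ((DD_tendsto_one z hz hz1).comp qr_tendsto_one).pow 2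
    refine (t1.sub t2).congr' ?_
    filter_upwards [ev_Ioo] with x hx
    exact (hphi x hx).symm
  have big : 1 < (1 / Real.cos z) ^ 2 - 1 ^ 2 := by
    have : 2 < (1 / Real.cos z) ^ 2 := by
      rw [div_pow, lt_div_iff₀ (by positivity)]
      linarith
    linarith
  have half : phi u (1/2) = 0 := by
    rw [hphi (1/2) ⟨by norm_num, by norm_num⟩]
    norm_num
  obtain ⟨b, hb1, hb⟩ := ((lim.eventually (lt_mem_nhds big)).and
    (Ioo_mem_nhdsLT (show (1/2:ℝ) < 1 by norm_num))).exists
  have ivt := intermediate_value_Icc hb.1.le (f := phi u) (fun x hx =>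
    (cont x ⟨by linarith [hx.1], by linarith [hx.2, hb.2]⟩).continuousWithinAt)
  obtain ⟨t, ht, htt⟩ := ivt (show (1:ℝ) ∈ _ from ⟨by rw [half]; norm_num, hb1.le⟩)
  have ht2 : 1/2 < t := by
    rcases eq_or_lt_of_le ht.1 with h | h
    · rw [← h, half] at htt; norm_num at htt
    · exact h
  have ht01 : t ∈ Ioo (0:ℝ) 1 := ⟨by linarith, by linarith [ht.2, hb.2]⟩
  refine ⟨t, ⟨ht2, ht01.2⟩, htt, ?_, ?_, ?_⟩
  · intro m hm h
    rcases lt_trichotomy m t with hlt | heq | hgt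
    · have := mono m hm t ht01 hlt; linarith
    · exact heq
    · have := mono t ht01 m hm hgt; linarith
  · intro m hm h
    rw [← htt]; exact mono m hm t ht01 h
  · intro m hm h
    rw [← htt]; exact mono t ht01 m hm h
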